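/- arXiv:2512.24655 — 2 statements merged into one kernel-verified Lean document; each statement's English description precedes it below -/
import Mathlib

section
/- Let X and Y be nonempty finite types, T > 0 a real number, E_X : X → ℝ and E_Y : Y → ℝ energy functions, and p : X × Y → ℝ a probability mass function with marginals p_X and p_Y. Define the Shannon entropy H(r) := −Σ r·log r, the nonequilibrium free energies F_X[p_X] := Σ_x p_X(x)E_X(x) − T·H(p_X), F_Y[p_Y] := Σ_y p_Y(y)E_Y(y) − T·H(p_Y), F_XY[p] := Σ_{x,y} p(x,y)(E_X(x) + E_Y(y)) − T·H(p), and the mutual information I(X;Y) := D(p ‖ p_X ⊗ p_Y) where (p_X ⊗ p_Y)(x,y) := p_X(x)·p_Y(y). Then F_XY[p] = F_X[p_X] + F_Y[p_Y] + T·I(X;Y). -/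
open Finset

/-- Relative entropy `D(p‖q)`, summand `0` whenever `p(z) = 0`. -/
noncomputable def relEnt {Ω : Type*} [Fintype Ω] (p q : Ω → ℝ) : ℝ :=
  ∑ z, if p z = 0 then 0 else p z * Real.log (p z / q z)

/-- Shannon entropy `H(r) = -∑_z r(z) log r(z)`, summand `0` whenever `r(z) = 0`. -/
noncomputable def shannonEnt {Ω : Type*} [Fintype Ω] (r : Ω → ℝ) : ℝ :=
  -∑ z, if r z = 0 then 0 else r z * Real.log (r z)

theorem sum_mul_fst {X Y : Type*} [Fintype X] [Fintype Y] (p : X × Y → ℝ) (f : X → ℝ) :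
    ∑ z, p z * f z.1 = ∑ x, (∑ y, p (x, y)) * f x := by
  simp only [Fintype.sum_prod_type, sum_mul]

theorem sum_mul_snd {X Y : Type*} [Fintype X] [Fintype Y] (p : X × Y → ℝ) (f : Y → ℝ) :
    ∑ z, p z * f z.2 = ∑ y, (∑ x, p (x, y)) * f y := by
  simp only [Fintype.sum_prod_type_right, sum_mul]

theorem shannonEnt_eq_neg_sum {Ω : Type*} [Fintype Ω] (r : Ω → ℝ) :
    shannonEnt r = -∑ z, r z * Real.log (r z) := by
  rw [shannonEnt]
  congr 1
  refine sum_congr rfl fun z _ => ?_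
  split_ifs with hz <;> simp [hz]

/-- The relative entropy of a joint mass function to the product of its marginals is
`H(p_X) + H(p_Y) - H(p)`. -/
theorem relEnt_prod_marginals {X Y : Type*} [Fintype X] [Fintype Y]
    (p : X × Y → ℝ) (hp0 : ∀ z, 0 ≤ p z)
    (pX : X → ℝ) (hpX : ∀ x, pX x = ∑ y, p (x, y))
    (pY : Y → ℝ) (hpY : ∀ y, pY y = ∑ x, p (x, y)) :
    relEnt p (fun z => pX z.1 * pY z.2) = shannonEnt pX + shannonEnt pY - shannonEnt p := by
  have hsummand (z : X × Y) :
      (if p z = 0 then 0 else p z * Real.log (p z / (pX z.1 * pY z.2))) =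
        p z * Real.log (p z) - p z * Real.log (pX z.1) - p z * Real.log (pY z.2) := by
    split_ifs with hz
    · simp [hz]
    · have hpos : 0 < p z := (hp0 z).lt_of_ne' hz
      have hX : 0 < pX z.1 := by
        rw [hpX]
        exact hpos.trans_le
          (single_le_sum (f := fun y => p (z.1, y)) (fun y _ => hp0 _) (mem_univ z.2))
      have hY : 0 < pY z.2 := by
        rw [hpY]
        exact hpos.trans_le
          (single_le_sum (f := fun x => p (x, z.2)) (fun x _ => hp0 _) (mem_univ z.1))
      rw [Real.log_div hz (mul_pos hX hY).ne', Real.log_mul hX.ne' hY.ne']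
      ring
  simp only [relEnt, hsummand, sum_sub_distrib, shannonEnt_eq_neg_sum]
  rw [sum_mul_fst p fun x => Real.log (pX x), sum_mul_snd p fun y => Real.log (pY y)]
  simp only [← hpX, ← hpY]
  ring

/-- free-energy decomposition with a correlation term: for an
additive Hamiltonian `E_XY(x,y) = E_X(x) + E_Y(y)` and temperature `T > 0`,
`F_XY[p] = F_X[p_X] + F_Y[p_Y] + T·I(X;Y)` where `I(X;Y) = D(p ‖ p_X ⊗ p_Y)`. -/
theorem free_energy_decomposition
    {X Y : Type*} [Fintype X] [Fintype Y] [Nonempty X] [Nonempty Y]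
    (T : ℝ) (hT : 0 < T)
    (EX : X → ℝ) (EY : Y → ℝ)
    (p : X × Y → ℝ) (hp0 : ∀ z, 0 ≤ p z) (hp1 : ∑ z, p z = 1)
    (pX : X → ℝ) (hpX : ∀ x, pX x = ∑ y, p (x, y))
    (pY : Y → ℝ) (hpY : ∀ y, pY y = ∑ x, p (x, y)) :
    (∑ z : X × Y, p z * (EX z.1 + EY z.2)) - T * shannonEnt p =
      ((∑ x, pX x * EX x) - T * shannonEnt pX)
        + ((∑ y, pY y * EY y) - T * shannonEnt pY)
        + T * relEnt p (fun z => pX z.1 * pY z.2) := by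
  rw [relEnt_prod_marginals p hp0 pX hpX pY hpY]
  simp only [mul_add, sum_add_distrib, sum_mul_fst, sum_mul_snd, ← hpX, ← hpY]
  ring
end

section
/- Let Ω, Y₁, Y₂ be nonempty finite types, τ : Ω → ℝ with τ(x) > 0 for all x, and let M₁ : Ω → Y₁ and M₂ : Ω → Y₂ be maps such that M₁ is a refinement of M₂, i.e. there exists g : Y₁ → Y₂ with M₂ = g ∘ M₁. For a probability mass function p on Ω, define the observational entropy S_{M,τ}(p) := −Σ_{y} p(M⁻¹(y)) · log( p(M⁻¹(y)) / τ(M⁻¹(y)) ), where p(M⁻¹(y)) := Σ_{x : M(x)=y} p(x) and τ(M⁻¹(y)) := Σ_{x : M(x)=y} τ(x), with summands taken to be 0 when p(M⁻¹(y)) = 0 and the sum ranging over y in the image of M. Then S_{M₁,τ}(p) ≤ S_{M₂,τ}(p): refining the measurement can only decrease observational entropy. -/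
open Finset

/-- Observational entropy of a pmf `p` on `Ω` with respect to a measurement map
`M : Ω → Y` and reference weights `τ`:
`S_{M,τ}(p) = -∑_y p(M⁻¹(y)) · log (p(M⁻¹(y)) / τ(M⁻¹(y)))`,
summands taken to be `0` whenever `p(M⁻¹(y)) = 0` (which also covers `y`
outside the image of `M`). -/
noncomputable def obsEnt {Ω Y : Type*} [Fintype Ω] [Fintype Y] [DecidableEq Y]
    (M : Ω → Y) (τ p : Ω → ℝ) : ℝ :=
  -∑ y, (if (∑ x ∈ Finset.univ.filter (fun x => M x = y), p x) = 0 then 0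
    else (∑ x ∈ Finset.univ.filter (fun x => M x = y), p x) *
      Real.log ((∑ x ∈ Finset.univ.filter (fun x => M x = y), p x)
        / (∑ x ∈ Finset.univ.filter (fun x => M x = y), τ x)))

/-- The log sum inequality. -/
theorem sum_mul_log_sum_div_sum_le {ι : Type*} (s : Finset ι) (a b : ι → ℝ)
    (ha : ∀ i ∈ s, 0 ≤ a i) (hb : ∀ i ∈ s, 0 ≤ b i) (hab : ∀ i ∈ s, b i = 0 → a i = 0) :
    (∑ i ∈ s, a i) * Real.log ((∑ i ∈ s, a i) / ∑ i ∈ s, b i) ≤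
      ∑ i ∈ s, a i * Real.log (a i / b i) := by
  set A := ∑ i ∈ s, a i with hA
  set B := ∑ i ∈ s, b i with hB
  have hB0 : 0 ≤ B := Finset.sum_nonneg hb
  have hA0 : 0 ≤ A := Finset.sum_nonneg ha
  have hterm : ∀ i ∈ s, a i * Real.log (A / B) + (a i - b i * (A / B)) ≤
      a i * Real.log (a i / b i) := by
    intro i hi
    rcases (ha i hi).eq_or_lt with h | h
    · have : 0 ≤ b i * (A / B) := mul_nonneg (hb i hi) (div_nonneg hA0 hB0)
      simpa [← h] using this
    · have hbi : 0 < b i := (hb i hi).lt_of_ne fun h0 => h.ne' (hab i hi h0.symm)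
      have hApos : 0 < A := h.trans_le (Finset.single_le_sum ha hi)
      have hBpos : 0 < B := hbi.trans_le (Finset.single_le_sum hb hi)
      have hx : 0 < a i / b i := div_pos h hbi
      have hy : 0 < A / B := div_pos hApos hBpos
      have key := mul_le_mul_of_nonneg_left
        (Real.one_sub_inv_le_log_of_pos (div_pos hx hy)) h.le
      rw [Real.log_div hx.ne' hy.ne'] at key
      have heq : a i * (1 - (a i / b i / (A / B))⁻¹) = a i - b i * (A / B) := by
        field_simp
      linarith
  have hAB : B * (A / B) = A := by
    refine mul_div_cancel_of_imp' fun h0 => Finset.sum_eq_zero fun i hi => hab i hi ?_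
    exact (Finset.sum_eq_zero_iff_of_nonneg hb).1 h0 i hi
  have hsum := Finset.sum_le_sum hterm
  rw [Finset.sum_add_distrib, Finset.sum_sub_distrib, ← Finset.sum_mul, ← Finset.sum_mul,
    ← hA, ← hB, hAB, sub_self, add_zero] at hsum
  exact hsum

theorem obsEnt_eq_neg_sum {Ω Y : Type*} [Fintype Ω] [Fintype Y] [DecidableEq Y]
    (M : Ω → Y) (τ p : Ω → ℝ) :
    obsEnt M τ p = -∑ y, (∑ x with M x = y, p x) *
      Real.log ((∑ x with M x = y, p x) / ∑ x with M x = y, τ x) := by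
  unfold obsEnt
  congr 1
  refine Finset.sum_congr rfl fun y _ => ?_
  split_ifs with h
  · rw [h, zero_mul]
  · rfl

/-- The mass of a coarse cell is the total mass of the fine cells it contains. -/
theorem sum_filter_comp_eq {Ω Y Z : Type*} [Fintype Ω] [Fintype Y]
    [DecidableEq Y] [DecidableEq Z] (M : Ω → Y) (g : Y → Z) (f : Ω → ℝ) (z : Z) :
    ∑ x with (g ∘ M) x = z, f x = ∑ y with g y = z, ∑ x with M x = y, f x := by
  rw [← Finset.sum_fiberwise_of_maps_to (s := {x | (g ∘ M) x = z}) (t := {y | g y = z})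
    (g := M) (by simp)]
  refine Finset.sum_congr rfl fun y hy => Finset.sum_congr ?_ fun _ _ => rfl
  ext x
  simp only [Finset.mem_filter, Finset.mem_univ, true_and, Function.comp_apply] at hy ⊢
  exact ⟨fun h => h.2, fun h => ⟨h ▸ hy, h⟩⟩

/-- refinement monotonicity of observational entropy — if `M₁` is
a refinement of `M₂` (i.e. `M₂ = g ∘ M₁` for some `g`), then
`S_{M₁,τ}(p) ≤ S_{M₂,τ}(p)`. -/
theorem obsEnt_refinement_mono
    {Ω Y₁ Y₂ : Type*} [Fintype Ω] [Fintype Y₁] [Fintype Y₂]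
    [Nonempty Ω] [Nonempty Y₁] [Nonempty Y₂]
    [DecidableEq Y₁] [DecidableEq Y₂]
    (τ : Ω → ℝ) (hτ : ∀ x, 0 < τ x)
    (p : Ω → ℝ) (hp0 : ∀ x, 0 ≤ p x) (hp1 : ∑ x, p x = 1)
    (M₁ : Ω → Y₁) (M₂ : Ω → Y₂)
    (g : Y₁ → Y₂) (hg : M₂ = g ∘ M₁) :
    obsEnt M₁ τ p ≤ obsEnt M₂ τ p := by
  subst hg
  rw [obsEnt_eq_neg_sum, obsEnt_eq_neg_sum, neg_le_neg_iff,
    ← Finset.sum_fiberwise Finset.univ g]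
  refine Finset.sum_le_sum fun z _ => ?_
  rw [sum_filter_comp_eq, sum_filter_comp_eq]
  refine sum_mul_log_sum_div_sum_le _ _ _ (fun _ _ => Finset.sum_nonneg fun x _ => hp0 x)
    (fun _ _ => Finset.sum_nonneg fun x _ => (hτ x).le) fun y _ h => ?_
  refine Finset.sum_eq_zero fun x hx => absurd ?_ (hτ x).ne'
  exact (Finset.sum_eq_zero_iff_of_nonneg fun x _ => (hτ x).le).1 h x hx
end
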